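/- Let γ′ > 0 satisfy γ′ < 1 − d/4. Then there exists a constant C > 0 such that for all t > s ≥ 0 and all x ∈ D, ∫_0^s ∫_D |G(x,z,t−r) − G(x,z,s−r)|² dz dr ≤ C |t−s|^{γ′}. -/

import Mathlib

open MeasureTheory Real Set

noncomputable section

/-- The spatial domain `D = (0,π)^d` as a subset of Euclidean space. -/
def domD (d : ℕ) : Set (EuclideanSpace ℝ (Fin d)) :=
  {x | ∀ i, x i ∈ Set.Ioo (0 : ℝ) π}

/-- One-dimensional normalized cosine functions: `ε_0 = 1/√π`, `ε_j(x) = √(2/π) cos(jx)`. -/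
def eps1 (j : ℕ) (x : ℝ) : ℝ :=
  if j = 0 then 1 / Real.sqrt π else Real.sqrt (2 / π) * Real.cos (j * x)

/-- The product functions `ε_k(x) = ∏ i, ε_{k i}(x i)` for a multi-index `k ∈ ℕ^d`. -/
def epsk {d : ℕ} (k : Fin d → ℕ) (x : EuclideanSpace ℝ (Fin d)) : ℝ :=
  ∏ i, eps1 (k i) (x i)

/-- The eigenvalue `λ_k = ∑ i, k_i²`. -/
def lam {d : ℕ} (k : Fin d → ℕ) : ℝ := ∑ i, (k i : ℝ) ^ 2

/-- The Green's function of `−Δ²+Δ` with homogeneous Neumann boundary conditions on `D`: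
`G(x,y,t) = ∑_{k∈ℕ^d} e^{−(λ_k²+λ_k)t} ε_k(x) ε_k(y)`. -/
def green {d : ℕ} (x y : EuclideanSpace ℝ (Fin d)) (t : ℝ) : ℝ :=
  ∑' k : Fin d → ℕ, Real.exp (-(lam k ^ 2 + lam k) * t) * epsk k x * epsk k y

lemma abs_eps1_le (j : ℕ) (x : ℝ) : |eps1 j x| ≤ 1 := by
  have hπ := Real.pi_gt_three
  unfold eps1
  split_ifs
  · have h1 : (1 : ℝ) ≤ Real.sqrt π := by
      rw [Real.one_le_sqrt]; linarith
    rw [abs_of_nonneg (by positivity), div_le_one (by positivity)]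
    exact h1
  · rw [abs_mul, abs_of_nonneg (Real.sqrt_nonneg _)]
    have h1 : Real.sqrt (2 / π) ≤ 1 := by
      rw [Real.sqrt_le_one, div_le_one (by positivity)]; linarith
    exact mul_le_one₀ h1 (abs_nonneg _) (Real.abs_cos_le_one _)

lemma abs_epsk_le {d : ℕ} (k : Fin d → ℕ) (x : EuclideanSpace ℝ (Fin d)) : |epsk k x| ≤ 1 := by
  unfold epsk
  rw [Finset.abs_prod]
  exact Finset.prod_le_one (fun _ _ => abs_nonneg _) (fun _ _ => abs_eps1_le _ _)

lemma continuous_eps1 (j : ℕ) : Continuous (eps1 j) := by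
  unfold eps1
  split_ifs <;> fun_prop

lemma continuous_epsk {d : ℕ} (k : Fin d → ℕ) : Continuous (epsk k) := by
  unfold epsk
  refine continuous_finsetProd _ fun i _ => (continuous_eps1 _).comp ?_
  fun_prop

lemma integral_cos_int {a : ℝ} (n : ℤ) (hn : (n : ℝ) = a) (ha : a ≠ 0) :
    ∫ x in (0 : ℝ)..π, Real.cos (a * x) = 0 := by
  rw [intervalIntegral.integral_comp_mul_left (fun x => Real.cos x) ha, integral_cos, ← hn,
    Real.sin_int_mul_pi]
  simp

lemma integral_cos_cos {j l : ℕ} (h : j ≠ l) :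
    ∫ x in (0 : ℝ)..π, Real.cos (j * x) * Real.cos (l * x) = 0 := by
  have e : ∀ x : ℝ, Real.cos (j * x) * Real.cos (l * x)
      = (1/2) * (Real.cos (((j:ℝ) - l) * x) + Real.cos (((j:ℝ) + l) * x)) := by
    intro x
    rw [sub_mul, add_mul, Real.cos_sub, Real.cos_add]; ring
  simp_rw [e]
  rw [intervalIntegral.integral_const_mul, intervalIntegral.integral_add
    (Continuous.intervalIntegrable (by fun_prop) _ _)
    (Continuous.intervalIntegrable (by fun_prop) _ _),
    integral_cos_int ((j : ℤ) - l) (by push_cast; rfl)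
      (by rw [sub_ne_zero]; exact_mod_cast h),
    integral_cos_int ((j : ℤ) + l) (by push_cast; rfl)
      (by norm_cast; omega)]
  simp

lemma eps1_eq (j : ℕ) : ∃ a : ℝ, ∀ x, eps1 j x = a * Real.cos (j * x) := by
  by_cases h : j = 0
  · exact ⟨1 / Real.sqrt π, fun x => by simp [eps1, h]⟩
  · exact ⟨Real.sqrt (2 / π), fun x => by simp [eps1, h]⟩

lemma integral_eps1 {j l : ℕ} (h : j ≠ l) :
    ∫ x in Ioo (0 : ℝ) π, eps1 j x * eps1 l x = 0 := by
  obtain ⟨a, ha⟩ := eps1_eq j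
  obtain ⟨b, hb⟩ := eps1_eq l
  rw [← integral_Ioc_eq_integral_Ioo, ← intervalIntegral.integral_of_le Real.pi_pos.le]
  have e : ∀ x : ℝ, eps1 j x * eps1 l x = (a * b) * (Real.cos (j * x) * Real.cos (l * x)) := by
    intro x; rw [ha, hb]; ring
  simp_rw [e]
  rw [intervalIntegral.integral_const_mul, integral_cos_cos h, mul_zero]

lemma domD_eq (d : ℕ) : (WithLp.toLp 2 : (Fin d → ℝ) → EuclideanSpace ℝ (Fin d)) ⁻¹' domD d
    = Set.univ.pi fun _ => Ioo (0 : ℝ) π := by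
  ext x; simp [domD, Set.mem_pi]

lemma measurableSet_domD (d : ℕ) : MeasurableSet (domD d) := by
  have : domD d = ⋂ i, (fun x : EuclideanSpace ℝ (Fin d) => x i) ⁻¹' Ioo (0:ℝ) π := by
    ext x; simp [domD]
  rw [this]
  exact MeasurableSet.iInter fun i => (measurableSet_Ioo).preimage (by fun_prop)

lemma volume_domD_lt (d : ℕ) : volume (domD d) < ⊤ := by
  rw [← (PiLp.volume_preserving_toLp (Fin d)).measure_preimage
    (measurableSet_domD d).nullMeasurableSet, domD_eq, Real.volume_pi_Ioo]
  exact ENNReal.prod_lt_top (fun _ _ => ENNReal.ofReal_lt_top)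

lemma integral_epsk {d : ℕ} {k l : Fin d → ℕ} (h : k ≠ l) :
    ∫ z in domD d, epsk k z * epsk l z = 0 := by
  obtain ⟨i, hi⟩ := Function.ne_iff.mp h
  rw [← (PiLp.volume_preserving_toLp (Fin d)).setIntegral_preimage_emb
    (MeasurableEquiv.toLp 2 (Fin d → ℝ)).measurableEmbedding, domD_eq]
  have e : ∀ x : Fin d → ℝ, epsk k (WithLp.toLp 2 x) * epsk l (WithLp.toLp 2 x)
      = ∏ i, (fun i y => eps1 (k i) y * eps1 (l i) y) i (x i) := by
    intro x; simp [epsk, Finset.prod_mul_distrib]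
  simp_rw [e]
  rw [volume_pi, Measure.restrict_pi_pi,
    integral_fintype_prod_eq_prod (fun i y => eps1 (k i) y * eps1 (l i) y)]
  exact Finset.prod_eq_zero (Finset.mem_univ i) (integral_eps1 hi)

/-- Bessel-type bound. -/
lemma bessel {d : ℕ} (c : (Fin d → ℕ) → ℝ) (hc : Summable fun k => |c k|) :
    ∫ z in domD d, (∑' k, c k * epsk k z) ^ 2 ≤ volume.real (domD d) * ∑' k, c k ^ 2 := by
  have : IsFiniteMeasure (volume.restrict (domD d)) := ⟨by simpa using volume_domD_lt d⟩
  have hs : ∀ z, Summable fun k => c k * epsk k z := fun z => by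
    refine Summable.of_norm_bounded hc fun k => ?_
    rw [Real.norm_eq_abs, abs_mul]
    exact mul_le_of_le_one_right (abs_nonneg _) (abs_epsk_le _ _)
  have hc2 : Summable fun k => c k ^ 2 := by
    have h := hc.mul_of_nonneg hc (fun _ => abs_nonneg _) (fun _ => abs_nonneg _)
    have := h.comp_injective (i := fun k : Fin d → ℕ => (k, k)) (fun a b h => by simpa using h)
    refine this.congr fun k => ?_
    simp [← sq]
  have hlim : Filter.Tendsto (fun S : Finset (Fin d → ℕ) =>
      ∫ z in domD d, (∑ k ∈ S, c k * epsk k z) ^ 2) Filter.atTop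
      (nhds (∫ z in domD d, (∑' k, c k * epsk k z) ^ 2)) := by
    refine tendsto_integral_filter_of_dominated_convergence (fun _ => (∑' k, |c k|) ^ 2) ?_ ?_
      (integrable_const _) ?_
    · refine Filter.Eventually.of_forall fun S => Continuous.aestronglyMeasurable ?_
      refine (continuous_finsetSum _ fun k _ => ?_).pow 2
      exact continuous_const.mul (continuous_epsk k)
    · refine Filter.Eventually.of_forall fun S => Filter.Eventually.of_forall fun z => ?_
      rw [Real.norm_eq_abs, abs_pow]
      refine pow_le_pow_left₀ (abs_nonneg _) ?_ 2
      refine (Finset.abs_sum_le_sum_abs _ _).trans ?_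
      refine le_trans (Finset.sum_le_sum fun k _ => ?_)
        (hc.sum_le_tsum S (fun _ _ => abs_nonneg _))
      rw [abs_mul]
      exact mul_le_of_le_one_right (abs_nonneg _) (abs_epsk_le _ _)
    · exact Filter.Eventually.of_forall fun z => ((hs z).hasSum.pow 2)
  refine le_of_tendsto hlim (Filter.Eventually.of_forall fun S => ?_)
  have hint : ∀ k l, Integrable (fun z => epsk k z * epsk l z) (volume.restrict (domD d)) := by
    intro k l
    refine Integrable.of_bound
      ((continuous_epsk k).mul (continuous_epsk l)).aestronglyMeasurable 1
      (Filter.Eventually.of_forall fun z => ?_)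
    rw [Real.norm_eq_abs, abs_mul]
    exact mul_le_one₀ (abs_epsk_le _ _) (abs_nonneg _) (abs_epsk_le _ _)
  have e : ∀ z, (∑ k ∈ S, c k * epsk k z) ^ 2
      = ∑ k ∈ S, ∑ l ∈ S, (c k * c l) * (epsk k z * epsk l z) := by
    intro z
    rw [sq, Finset.sum_mul_sum]
    refine Finset.sum_congr rfl fun k _ => Finset.sum_congr rfl fun l _ => by ring
  simp_rw [e]
  rw [integral_finsetSum _ fun k _ => integrable_finsetSum _ fun l _ => (hint k l).const_mul _]
  calc _ = ∑ k ∈ S, c k ^ 2 * ∫ z in domD d, epsk k z * epsk k z := by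
        refine Finset.sum_congr rfl fun k hk => ?_
        rw [integral_finsetSum _ fun l _ => (hint k l).const_mul _]
        rw [Finset.sum_eq_single k]
        · rw [integral_const_mul, sq]
        · intro l _ hl
          rw [integral_const_mul, integral_epsk hl.symm, mul_zero]
        · intro h; exact absurd hk h
    _ ≤ ∑ k ∈ S, c k ^ 2 * volume.real (domD d) := by
        refine Finset.sum_le_sum fun k _ => mul_le_mul_of_nonneg_left ?_ (sq_nonneg _)
        have : ∫ z in domD d, epsk k z * epsk k z ≤ ∫ z in domD d, (1:ℝ) := by
          refine integral_mono (hint k k) (integrable_const _) fun z => ?_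
          have := abs_epsk_le k z
          simp only
          rw [← sq, ← sq_abs]
          exact pow_le_one₀ (abs_nonneg _) this
        simpa using this
    _ = volume.real (domD d) * ∑ k ∈ S, c k ^ 2 := by rw [← Finset.sum_mul, mul_comm]
    _ ≤ _ := mul_le_mul_of_nonneg_left (hc2.sum_le_tsum S fun _ _ => sq_nonneg _) (by positivity)

lemma summable_pi_prod (d : ℕ) (f : ℕ → ℝ) (hf : Summable f) (h0 : ∀ n, 0 ≤ f n) :
    Summable fun k : Fin d → ℕ => ∏ i, f (k i) := by
  induction d with
  | zero => exact (hasSum_fintype _).summable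
  | succ d ih =>
    rw [← (Fin.consEquiv fun _ => ℕ).summable_iff]
    refine (hf.mul_of_nonneg ih h0 fun k => Finset.prod_nonneg fun _ _ => h0 _).congr fun p => ?_
    simp [Fin.prod_univ_succ, Fin.consEquiv]

lemma lam_nonneg {d : ℕ} (k : Fin d → ℕ) : 0 ≤ lam k := Finset.sum_nonneg fun _ _ => sq_nonneg _

lemma sq_le_lam {d : ℕ} (k : Fin d → ℕ) (i : Fin d) : (k i : ℝ) ^ 2 ≤ lam k :=
  Finset.single_le_sum (f := fun i => (k i : ℝ) ^ 2) (fun _ _ => sq_nonneg _) (Finset.mem_univ i)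

lemma one_le_lam {d : ℕ} {k : Fin d → ℕ} (h : k ≠ 0) : 1 ≤ lam k := by
  obtain ⟨i, hi⟩ := Function.ne_iff.mp h
  refine le_trans ?_ (sq_le_lam k i)
  have : (1:ℝ) ≤ k i := by exact_mod_cast Nat.one_le_iff_ne_zero.mpr hi
  exact one_le_pow₀ this

lemma summable_exp {d : ℕ} {τ : ℝ} (hτ : 0 < τ) :
    Summable fun k : Fin d → ℕ => Real.exp (-(lam k ^ 2 + lam k) * τ) := by
  have h1 : Summable fun n : ℕ => Real.exp (n * (-τ)) :=
    Real.summable_exp_nat_mul_iff.mpr (by linarith)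
  refine Summable.of_nonneg_of_le (fun _ => (Real.exp_pos _).le) (fun k => ?_)
    (summable_pi_prod d _ h1 fun _ => (Real.exp_pos _).le)
  rw [← Real.exp_sum, Real.exp_le_exp, ← Finset.sum_mul]
  have h2 : ∑ i, (k i : ℝ) ≤ lam k := by
    refine Finset.sum_le_sum fun i _ => ?_
    exact_mod_cast Nat.le_self_pow two_ne_zero (k i)
  nlinarith [sq_nonneg (lam k)]

lemma summable_lam {d : ℕ} (hd : 0 < d) {p : ℝ} (hp : (d : ℝ) / 2 < p) :
    Summable fun k : Fin d → ℕ => (1 + lam k) ^ (-p) := by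
  have hd' : (0:ℝ) < d := by exact_mod_cast hd
  have hp0 : 0 < p := lt_trans (by positivity) hp
  have h1 : Summable fun n : ℕ => (1 + (n:ℝ) ^ 2) ^ (-(p / d)) := by
    have h2 : Summable fun n : ℕ => ((n:ℝ) ^ (-(2 * p / d))) := by
      rw [Real.summable_nat_rpow]
      rw [neg_lt_neg_iff, lt_div_iff₀ hd']; linarith
    rw [← summable_nat_add_iff 1] at h2 ⊢
    refine Summable.of_nonneg_of_le (fun _ => by positivity) (fun n => ?_) h2
    have hn : (0:ℝ) < ((n + 1 : ℕ) : ℝ) := by positivity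
    have e : ((n + 1 : ℕ) : ℝ) ^ (-(2 * p / d)) = (((n + 1 : ℕ) : ℝ) ^ 2) ^ (-(p / d)) := by
      rw [← Real.rpow_natCast, ← Real.rpow_mul hn.le]; congr 1; push_cast; ring
    rw [e]
    exact Real.rpow_le_rpow_of_nonpos (by positivity) (by linarith)
      (by rw [neg_nonpos]; positivity)
  refine Summable.of_nonneg_of_le (fun k => by have := lam_nonneg k; positivity) (fun k => ?_)
    (summable_pi_prod d _ h1 fun _ => by positivity)
  have hl := lam_nonneg k
  have e : (1 + lam k) ^ (-p) = ∏ i : Fin d, (1 + lam k) ^ (-(p / d)) := by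
    rw [Finset.prod_const, Finset.card_univ, Fintype.card_fin, ← Real.rpow_natCast,
      ← Real.rpow_mul (by positivity)]
    congr 1; field_simp
  rw [e]
  refine Finset.prod_le_prod (fun _ _ => by positivity) fun i _ => ?_
  exact Real.rpow_le_rpow_of_nonpos (by positivity) (by linarith [sq_le_lam k i])
      (by rw [neg_nonpos]; positivity)

lemma one_sub_exp_sq_le {y γ : ℝ} (hy : 0 ≤ y) (h0 : 0 < γ) (h1 : γ < 1) :
    (1 - Real.exp (-y)) ^ 2 ≤ y ^ γ := by
  have a1 : 0 ≤ 1 - Real.exp (-y) := by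
    have := Real.exp_le_one_iff.mpr (neg_nonpos.mpr hy); linarith
  have a2 : 1 - Real.exp (-y) ≤ 1 := by linarith [Real.exp_pos (-y)]
  have a3 : 1 - Real.exp (-y) ≤ y := by linarith [Real.add_one_le_exp (-y)]
  rcases le_total y 1 with h | h
  · have : y ≤ y ^ γ := by
      rcases hy.eq_or_lt with h' | h'
      · rw [← h', Real.zero_rpow h0.ne']
      · simpa using Real.rpow_le_rpow_of_exponent_ge h' h h1.le
    nlinarith
  · have : 1 ≤ y ^ γ := Real.one_le_rpow h h0.le
    nlinarith

lemma time_bound {m s t γ : ℝ} (hm : 0 < m) (hs : 0 ≤ s) (hst : s < t) (h0 : 0 < γ) (h1 : γ < 1) :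
    ∫⁻ r in Ioc (0:ℝ) s, ENNReal.ofReal ((Real.exp (-m * (t - r)) - Real.exp (-m * (s - r))) ^ 2)
      ≤ ENNReal.ofReal ((t - s) ^ γ * m ^ (γ - 1)) := by
  rw [← ofReal_integral_eq_lintegral_ofReal]
  · apply ENNReal.ofReal_le_ofReal
    rw [← intervalIntegral.integral_of_le hs]
    have e : ∀ r : ℝ, (Real.exp (-m * (t - r)) - Real.exp (-m * (s - r))) ^ 2
        = (1 - Real.exp (-(m * (t - s)))) ^ 2 * Real.exp (-2 * m * (s - r)) := by
      intro r
      have e1 : Real.exp (-m * (t - r)) = Real.exp (-m * (s - r)) * Real.exp (-(m * (t - s))) := by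
        rw [← Real.exp_add]; congr 1; ring
      have e2 : Real.exp (-2 * m * (s - r)) = Real.exp (-m * (s - r)) ^ 2 := by
        rw [sq, ← Real.exp_add]; congr 1; ring
      rw [e1, e2]; ring
    simp_rw [e]
    rw [intervalIntegral.integral_const_mul]
    have hI : ∫ r in (0:ℝ)..s, Real.exp (-2 * m * (s - r)) ≤ m⁻¹ := by
      rw [intervalIntegral.integral_eq_sub_of_hasDerivAt
        (f := fun r => Real.exp (-2 * m * (s - r)) / (2 * m))]
      · have := Real.exp_pos (-2 * m * (s - 0))
        simp only [sub_self, mul_zero, Real.exp_zero]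
        have : (0:ℝ) ≤ Real.exp (-2 * m * (s - 0)) / (2 * m) := by positivity
        have h3 : 1 / (2 * m) ≤ m⁻¹ := by
          rw [← one_div]; exact one_div_le_one_div_of_le hm (by linarith)
        linarith
      · intro r _
        have := ((((hasDerivAt_id r).const_sub s).const_mul (-2 * m)).exp).div_const (2 * m)
        have e3 : Real.exp (-2 * m * (s - r))
            = Real.exp (-2 * m * (s - id r)) * (-2 * m * -1) / (2 * m) := by
          simp only [id]
          field_simp
        rw [e3]
        exact this
      · exact Continuous.intervalIntegrable (by fun_prop) _ _
    have hy : 0 ≤ m * (t - s) := by nlinarith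
    calc _ ≤ (m * (t - s)) ^ γ * m⁻¹ := by
          refine mul_le_mul (one_sub_exp_sq_le hy h0 h1) hI ?_ (by positivity)
          exact intervalIntegral.integral_nonneg hs fun _ _ => (Real.exp_pos _).le
      _ = _ := by
          rw [Real.mul_rpow hm.le (by linarith), Real.rpow_sub_one hm.ne']
          field_simp
  · exact (Continuous.integrableOn_Icc (by fun_prop)).mono_set Ioc_subset_Icc_self
  · exact Filter.Eventually.of_forall fun _ => sq_nonneg _

lemma mu_bound {d : ℕ} {k : Fin d → ℕ} (hk : k ≠ 0) {γ : ℝ} (h1 : γ < 1) :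
    (lam k ^ 2 + lam k) ^ (γ - 1) ≤ 2 ^ (1 - γ) * (1 + lam k) ^ (-(2 * (1 - γ))) := by
  have hl := one_le_lam hk
  have e : (2:ℝ) ^ (1 - γ) * (1 + lam k) ^ (-(2 * (1 - γ))) = ((1 + lam k) ^ 2 / 2) ^ (γ - 1) := by
    rw [Real.div_rpow (by positivity) (by norm_num), ← Real.rpow_natCast (1 + lam k) 2,
      ← Real.rpow_mul (by positivity), div_eq_mul_inv, ← Real.rpow_neg (by norm_num), mul_comm]
    congr 2
    · push_cast; ring
    · ring
  rw [e]
  exact Real.rpow_le_rpow_of_nonpos (by positivity) (by nlinarith) (by linarith)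

lemma inner_bound {d : ℕ} {s t r : ℝ} (hst : s < t) (hr : r < s) (x : EuclideanSpace ℝ (Fin d)) :
    ENNReal.ofReal ‖∫ z in domD d, |green x z (t - r) - green x z (s - r)| ^ 2‖
      ≤ ENNReal.ofReal (volume.real (domD d)) * ∑' k : Fin d → ℕ,
        ENNReal.ofReal ((Real.exp (-(lam k ^ 2 + lam k) * (t - r))
          - Real.exp (-(lam k ^ 2 + lam k) * (s - r))) ^ 2) := by
  set a : (Fin d → ℕ) → ℝ := fun k => Real.exp (-(lam k ^ 2 + lam k) * (t - r))
          - Real.exp (-(lam k ^ 2 + lam k) * (s - r)) with ha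
  have h1 := summable_exp (d := d) (τ := t - r) (by linarith)
  have h2 := summable_exp (d := d) (τ := s - r) (by linarith)
  have hasum : Summable fun k => |a k| := (h1.sub h2).abs
  have ha2 : Summable fun k => a k ^ 2 := by
    have h := hasum.mul_of_nonneg hasum (fun _ => abs_nonneg _) (fun _ => abs_nonneg _)
    have := h.comp_injective (i := fun k : Fin d → ℕ => (k, k)) (fun a b h => by simpa using h)
    refine this.congr fun k => ?_
    simp [← sq]
  have hle : ∀ k, |a k * epsk k x| ≤ |a k| := fun k => by
    rw [abs_mul]; exact mul_le_of_le_one_right (abs_nonneg _) (abs_epsk_le _ _)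
  have hc : Summable fun k => |a k * epsk k x| :=
    Summable.of_nonneg_of_le (fun _ => abs_nonneg _) hle hasum
  have hg : ∀ z (f : (Fin d → ℕ) → ℝ), (∀ k, 0 ≤ f k) → Summable f →
      Summable fun k => f k * epsk k x * epsk k z := by
    intro z f hf0 hf
    refine Summable.of_norm_bounded hf fun k => ?_
    rw [Real.norm_eq_abs, abs_mul, abs_mul, abs_of_nonneg (hf0 k), mul_assoc]
    exact mul_le_of_le_one_right (hf0 k)
      (mul_le_one₀ (abs_epsk_le _ _) (abs_nonneg _) (abs_epsk_le _ _))
  have e : ∀ z, |green x z (t - r) - green x z (s - r)| ^ 2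
      = (∑' k, (a k * epsk k x) * epsk k z) ^ 2 := by
    intro z
    rw [sq_abs]
    unfold green
    rw [← (hg z _ (fun _ => (Real.exp_pos _).le) h1).tsum_sub
      (hg z _ (fun _ => (Real.exp_pos _).le) h2)]
    congr 2
    ext k
    simp only [ha]; ring
  simp_rw [e]
  rw [Real.norm_of_nonneg (integral_nonneg fun _ => sq_nonneg _),
    ← ENNReal.ofReal_tsum_of_nonneg (fun _ => sq_nonneg _) ha2,
    ← ENNReal.ofReal_mul (by positivity)]
  refine ENNReal.ofReal_le_ofReal ((bessel _ hc).trans ?_)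
  refine mul_le_mul_of_nonneg_left ?_ (by positivity)
  have hle2 : ∀ k, (a k * epsk k x) ^ 2 ≤ a k ^ 2 := fun k => sq_le_sq.mpr (hle k)
  exact Summable.tsum_le_tsum hle2 (Summable.of_nonneg_of_le (fun _ => sq_nonneg _) hle2 ha2) ha2

/-- Hölder estimate in time for the squared `L²` increment of the Green's function:
for `0 < γ′ < 1 − d/4` there is `C > 0` such that for `t > s ≥ 0` and `x ∈ D`,
`∫_0^s ∫_D |G(x,z,t−r) − G(x,z,s−r)|² dz dr ≤ C |t−s|^{γ′}`. -/
theorem statement7 (d : ℕ) (hd : d = 1 ∨ d = 2 ∨ d = 3) (γ' : ℝ)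
    (hγ0 : 0 < γ') (hγ1 : γ' < 1 - (d : ℝ) / 4) :
    ∃ C > (0 : ℝ), ∀ s t : ℝ, 0 ≤ s → s < t → ∀ x ∈ domD d,
      (∫ r in (0 : ℝ)..s, ∫ z in domD d,
          |green x z (t - r) - green x z (s - r)| ^ 2)
        ≤ C * |t - s| ^ γ' := by
  have hd0 : 0 < d := by omega
  have hd' : (0:ℝ) < d := by exact_mod_cast hd0
  have hγ : γ' < 1 := by linarith
  set V := volume.real (domD d) with hV
  set A : (Fin d → ℕ) → ℝ := fun k => 2 ^ (1 - γ') * (1 + lam k) ^ (-(2 * (1 - γ'))) with hA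
  have hA0 : ∀ k, 0 ≤ A k := fun k => by have := lam_nonneg k; positivity
  have hAs : Summable A := (summable_lam hd0 (by linarith)).mul_left _
  have hV0 : 0 ≤ V := by positivity
  have hS0 : 0 ≤ ∑' k, A k := tsum_nonneg hA0
  refine ⟨V * (∑' k, A k) + 1, by positivity, fun s t hs hst x _ => ?_⟩
  have hts : 0 < t - s := by linarith
  rw [abs_of_pos hts, intervalIntegral.integral_of_le hs]
  have key : ∫⁻ r in Ioc (0:ℝ) s,
      ENNReal.ofReal ‖∫ z in domD d, |green x z (t - r) - green x z (s - r)| ^ 2‖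
      ≤ ENNReal.ofReal (V * (∑' k, A k) * (t - s) ^ γ') := by
    calc _ ≤ ∫⁻ r in Ioc (0:ℝ) s, ENNReal.ofReal V * ∑' k : Fin d → ℕ,
        ENNReal.ofReal ((Real.exp (-(lam k ^ 2 + lam k) * (t - r))
          - Real.exp (-(lam k ^ 2 + lam k) * (s - r))) ^ 2) := by
          rw [← restrict_Ioo_eq_restrict_Ioc]
          exact setLIntegral_mono' measurableSet_Ioo fun r hr => inner_bound hst hr.2 x
      _ = ENNReal.ofReal V * ∑' k : Fin d → ℕ, ∫⁻ r in Ioc (0:ℝ) s,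
        ENNReal.ofReal ((Real.exp (-(lam k ^ 2 + lam k) * (t - r))
          - Real.exp (-(lam k ^ 2 + lam k) * (s - r))) ^ 2) := by
          rw [lintegral_const_mul' _ _ ENNReal.ofReal_ne_top, lintegral_tsum]
          intro k
          exact Measurable.aemeasurable (by fun_prop)
      _ ≤ ENNReal.ofReal V * ∑' k : Fin d → ℕ, ENNReal.ofReal (A k * (t - s) ^ γ') := by
          refine mul_le_mul_right (ENNReal.tsum_le_tsum fun k => ?_) _
          by_cases hk : k = 0
          · have : lam k = 0 := by simp [lam, hk]
            simp [this]
          · have hl := one_le_lam hk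
            refine (time_bound (by positivity) hs hst hγ0 hγ).trans (ENNReal.ofReal_le_ofReal ?_)
            rw [mul_comm]
            exact mul_le_mul_of_nonneg_right (mu_bound hk hγ) (by positivity)
      _ = _ := by
          rw [← ENNReal.ofReal_tsum_of_nonneg (fun k => mul_nonneg (hA0 k) (by positivity))
            (hAs.mul_right _), tsum_mul_right, ← ENNReal.ofReal_mul hV0, mul_assoc]
  calc _ ≤ ‖∫ r in Ioc (0:ℝ) s, ∫ z in domD d, |green x z (t - r) - green x z (s - r)| ^ 2‖ :=
        Real.le_norm_self _
    _ ≤ _ := norm_integral_le_lintegral_norm _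
    _ ≤ V * (∑' k, A k) * (t - s) ^ γ' := ENNReal.toReal_le_of_le_ofReal (by positivity) key
    _ ≤ _ := by
        refine mul_le_mul_of_nonneg_right (by linarith) (by positivity)
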